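/- arXiv:1612.05929 — 3 statements merged into one kernel-verified Lean document; each statement's English description precedes it below -/
import Mathlib

section
/- If R is a Hecke symmetry on V⊗V with parameter q (satisfying the braid relation and (qI−R)(q⁻¹I+R)=0), then the operator R(u,v) = R + g(u,v)·I with g(u,v) = (q−q⁻¹)/(b^{u−v} − 1) (b ≠ 0,1 fixed) satisfies the quantum Yang–Baxter equation R₁₂(u,v) R₂₃(u,w) R₁₂(v,w) = R₂₃(v,w) R₁₂(u,w) R₂₃(u,v). -/
open Matrix BigOperators

def lift12 {N : ℕ} (A : Matrix (Fin N × Fin N) (Fin N × Fin N) ℂ) :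
    Matrix (Fin N × Fin N × Fin N) (Fin N × Fin N × Fin N) ℂ :=
  Matrix.of fun p q => A (p.1, p.2.1) (q.1, q.2.1) * (if p.2.2 = q.2.2 then 1 else 0)

def lift23 {N : ℕ} (A : Matrix (Fin N × Fin N) (Fin N × Fin N) ℂ) :
    Matrix (Fin N × Fin N × Fin N) (Fin N × Fin N × Fin N) ℂ :=
  Matrix.of fun p q => (if p.1 = q.1 then 1 else 0) * A (p.2.1, p.2.2) (q.2.1, q.2.2)

/-- The trigonometric Baxterization R(u,v) = R + ((q−q⁻¹)/(b^{u−v}−1))·I. -/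
noncomputable def trigBax {N : ℕ} (R : Matrix (Fin N × Fin N) (Fin N × Fin N) ℂ)
    (q b u v : ℂ) : Matrix (Fin N × Fin N) (Fin N × Fin N) ℂ :=
  R + ((q - q⁻¹) / (b ^ (u - v) - 1)) • (1 : Matrix (Fin N × Fin N) (Fin N × Fin N) ℂ)

theorem lift12_add {N : ℕ} (A B : Matrix (Fin N × Fin N) (Fin N × Fin N) ℂ) :
    lift12 (A + B) = lift12 A + lift12 B := by
  ext p q
  simp only [lift12, Matrix.of_apply, Matrix.add_apply, add_mul]

theorem lift23_add {N : ℕ} (A B : Matrix (Fin N × Fin N) (Fin N × Fin N) ℂ) :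
    lift23 (A + B) = lift23 A + lift23 B := by
  ext p q
  simp only [lift23, Matrix.of_apply, Matrix.add_apply, mul_add]

theorem lift12_smul {N : ℕ} (c : ℂ) (A : Matrix (Fin N × Fin N) (Fin N × Fin N) ℂ) :
    lift12 (c • A) = c • lift12 A := by
  ext p q
  simp [lift12]

theorem lift23_smul {N : ℕ} (c : ℂ) (A : Matrix (Fin N × Fin N) (Fin N × Fin N) ℂ) :
    lift23 (c • A) = c • lift23 A := by
  ext p q
  simp [lift23]

theorem lift12_one {N : ℕ} :
    lift12 (1 : Matrix (Fin N × Fin N) (Fin N × Fin N) ℂ) = 1 := by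
  ext ⟨i, j, k⟩ ⟨i', j', k'⟩
  simp only [lift12, Matrix.of_apply, Matrix.one_apply, Prod.mk.injEq]
  grind

theorem lift23_one {N : ℕ} :
    lift23 (1 : Matrix (Fin N × Fin N) (Fin N × Fin N) ℂ) = 1 := by
  ext ⟨i, j, k⟩ ⟨i', j', k'⟩
  simp only [lift23, Matrix.of_apply, Matrix.one_apply, Prod.mk.injEq]
  grind

theorem lift12_mul {N : ℕ} (A B : Matrix (Fin N × Fin N) (Fin N × Fin N) ℂ) :
    lift12 (A * B) = lift12 A * lift12 B := by
  ext ⟨i, j, k⟩ ⟨i', j', k'⟩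
  simp [lift12, Matrix.mul_apply, Fintype.sum_prod_type]

theorem lift23_mul {N : ℕ} (A B : Matrix (Fin N × Fin N) (Fin N × Fin N) ℂ) :
    lift23 (A * B) = lift23 A * lift23 B := by
  ext ⟨i, j, k⟩ ⟨i', j', k'⟩
  by_cases h : i = i' <;>
    simp [lift23, Matrix.mul_apply, Fintype.sum_prod_type_right, h]

/-- The Hecke condition in quadratic form. -/
theorem mul_self_of_hecke {A : Type*} [Ring A] [Algebra ℂ A] {R : A} {q : ℂ} (hq : q ≠ 0)
    (h : (q • (1 : A) - R) * (q⁻¹ • (1 : A) + R) = 0) :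
    R * R = 1 + (q - q⁻¹) • R := by
  rw [← sub_eq_zero, ← neg_eq_zero, ← h]
  simp only [sub_mul, mul_add, smul_mul_assoc, mul_smul_comm, one_mul, mul_one]
  match_scalars <;> simp [hq, neg_add_eq_sub]

/-- Braided elements satisfying the same quadratic relation satisfy the Yang–Baxter equation
after shifts by scalars `a`, `c`, `d` with `a * d = c * (a + d + t)`. -/
theorem baxterization_of_braid {A : Type*} [Ring A] [Algebra ℂ A] {X Y : A} {t a c d : ℂ}
    (hbraid : X * Y * X = Y * X * Y) (hX : X * X = 1 + t • X) (hY : Y * Y = 1 + t • Y)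
    (h : a * d = c * (a + d + t)) :
    (X + a • (1 : A)) * (Y + c • (1 : A)) * (X + d • (1 : A)) =
      (Y + d • (1 : A)) * (X + c • (1 : A)) * (Y + a • (1 : A)) := by
  simp only [add_mul, mul_add, smul_mul_assoc, mul_smul_comm, one_mul, mul_one,
    hbraid, hX, hY]
  match_scalars <;> first | ring1 | linear_combination h | linear_combination -h

theorem trig_coeff_relation {t x y : ℂ} (hx : x ≠ 1) (hy : y ≠ 1) (hxy : x * y ≠ 1) :
    t / (x - 1) * (t / (y - 1)) = t / (x * y - 1) * (t / (x - 1) + t / (y - 1) + t) := by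
  have hx' := sub_ne_zero.mpr hx
  have hy' := sub_ne_zero.mpr hy
  have hxy' := sub_ne_zero.mpr hxy
  field_simp
  ring

/-- the trigonometric Baxterization of a Hecke symmetry satisfies
the quantum Yang–Baxter equation. -/
theorem trigonometric_baxterization_QYBE {N : ℕ}
    (R : Matrix (Fin N × Fin N) (Fin N × Fin N) ℂ) (q b : ℂ)
    (hbraid : lift12 R * lift23 R * lift12 R = lift23 R * lift12 R * lift23 R)
    (hHecke : (q • (1 : Matrix (Fin N × Fin N) (Fin N × Fin N) ℂ) - R) *
        (q⁻¹ • (1 : Matrix (Fin N × Fin N) (Fin N × Fin N) ℂ) + R) = 0)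
    (hq0 : q ≠ 0) (hq : q ^ 2 ≠ 1) (hb0 : b ≠ 0) (hb1 : b ≠ 1)
    (u v w : ℂ)
    (huv : b ^ (u - v) ≠ 1) (huw : b ^ (u - w) ≠ 1) (hvw : b ^ (v - w) ≠ 1) :
    lift12 (trigBax R q b u v) * lift23 (trigBax R q b u w) * lift12 (trigBax R q b v w) =
      lift23 (trigBax R q b v w) * lift12 (trigBax R q b u w) *
        lift23 (trigBax R q b u v) := by
  have hmul : b ^ (u - w) = b ^ (u - v) * b ^ (v - w) := by
    rw [← Complex.cpow_add _ _ hb0, sub_add_sub_cancel]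
  have hR := mul_self_of_hecke hq0 hHecke
  have hX : lift12 R * lift12 R = 1 + (q - q⁻¹) • lift12 R := by
    rw [← lift12_mul, hR, lift12_add, lift12_one, lift12_smul]
  have hY : lift23 R * lift23 R = 1 + (q - q⁻¹) • lift23 R := by
    rw [← lift23_mul, hR, lift23_add, lift23_one, lift23_smul]
  simp only [trigBax, lift12_add, lift23_add, lift12_smul, lift23_smul, lift12_one, lift23_one]
  refine baxterization_of_braid hbraid hX hY ?_
  rw [hmul] at huw ⊢
  exact trig_coeff_relation huv hvw huw
end

section
/- Under the same hypotheses, the partial R-traces of the top skew-symmetrizer satisfy Tr_{R(k+1,…,m)}(P⁽ᵐ⁾_{1…m}) = q^{−m(m−k)} (k_q! (m−k)_q!)/m_q! · P⁽ᵏ⁾_{1…k} for all 0 ≤ k ≤ m−1; in particular Tr_{R(1…m)}(P⁽ᵐ⁾) = q^{−m²}. -/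
open Matrix BigOperators

variable {K : Type*} [Field K]

def liftPos (k N : ℕ) (R : Matrix (Fin N × Fin N) (Fin N × Fin N) K) (i : ℕ) :
    Matrix (Fin k → Fin N) (Fin k → Fin N) K :=
  if h : i + 1 < k then
    Matrix.of (fun f g =>
      R (f ⟨i, Nat.lt_of_succ_lt h⟩, f ⟨i + 1, h⟩)
          (g ⟨i, Nat.lt_of_succ_lt h⟩, g ⟨i + 1, h⟩) *
        ∏ t ∈ Finset.univ.filter (fun t : Fin k => (t : ℕ) ≠ i ∧ (t : ℕ) ≠ i + 1),
          (if f t = g t then 1 else 0))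
  else 1

def qInt (q : K) (n : ℕ) : K := (q ^ n - q⁻¹ ^ n) / (q - q⁻¹)

/-- The q-factorial n_q! = 1_q 2_q ⋯ n_q. -/
def qFact (q : K) : ℕ → K
  | 0 => 1
  | n + 1 => qFact q n * qInt q (n + 1)

def skewSym (k N : ℕ) (q : K) (R : Matrix (Fin N × Fin N) (Fin N × Fin N) K) :
    ℕ → Matrix (Fin k → Fin N) (Fin k → Fin N) K
  | 0 => 1
  | 1 => 1
  | (n + 2) =>
      (qInt q (n + 1) / qInt q (n + 2)) •
        (skewSym k N q R (n + 1) *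
          ((q ^ (n + 1) / qInt q (n + 1)) • (1 : Matrix (Fin k → Fin N) (Fin k → Fin N) K) -
            liftPos k N R n) *
          skewSym k N q R (n + 1))

/-- Concatenation of a function on the first k indices with one on the last m−k. -/
def joinFin {k m N : ℕ} (hk : k ≤ m) (f : Fin k → Fin N) (a : Fin (m - k) → Fin N) :
    Fin m → Fin N := fun t =>
  if h : (t : ℕ) < k then f ⟨t, h⟩
  else a ⟨(t : ℕ) - k, by have := t.isLt; omega⟩

theorem qInt_sub_inv_ne_zero {q : K} (h1 : qInt q 1 ≠ 0) : q - q⁻¹ ≠ 0 := by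
  intro h
  simp [qInt, h] at h1

theorem qInt_one {q : K} (h1 : qInt q 1 ≠ 0) : qInt q 1 = 1 := by
  simp [qInt, div_self (qInt_sub_inv_ne_zero h1)]

theorem qInt_succ {q : K} (hq0 : q ≠ 0) (h1 : qInt q 1 ≠ 0) (n : ℕ) :
    qInt q (n + 1) = q ^ n + q⁻¹ * qInt q n := by
  have h := qInt_sub_inv_ne_zero h1
  have hq : q⁻¹ * q = 1 := inv_mul_cancel₀ hq0
  unfold qInt
  rw [eq_comm, eq_div_iff h, add_mul, mul_assoc, div_mul_cancel₀ _ h]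
  ring

theorem qFact_ne_zero {q : K} (hqgen : ∀ n : ℕ, 0 < n → qInt q n ≠ 0) (n : ℕ) :
    qFact q n ≠ 0 := by
  induction n with
  | zero => exact one_ne_zero
  | succ n ih => exact mul_ne_zero ih (hqgen _ n.succ_pos)

theorem pow_mul_qInt_sub {q : K} (hq0 : q ≠ 0) (M r : ℕ) :
    q ^ M * ((q ^ (M + r))⁻¹ * qInt q (M + r)) - qInt q M = (q ^ (M + r))⁻¹ * qInt q r := by
  simp only [qInt]
  rw [← mul_div_assoc, ← mul_div_assoc, ← mul_div_assoc, ← sub_div]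
  congr 1
  have hM : q ^ M * q⁻¹ ^ M = 1 := by rw [← mul_pow, mul_inv_cancel₀ hq0, one_pow]
  have hr : q ^ r * q⁻¹ ^ r = 1 := by rw [← mul_pow, mul_inv_cancel₀ hq0, one_pow]
  rw [← inv_pow, pow_add, pow_add]
  linear_combination (q⁻¹ ^ r * (q ^ M * q ^ r - q⁻¹ ^ M * q⁻¹ ^ r)) * hM + (q ^ M - q⁻¹ ^ M) * hr

/-- The fusion step: absorption of the next generator by the next skew-symmetrizer. -/
theorem fusion_absorb {A : Type*} [Ring A] [Algebra K A] {P P' R S : A} {α c c' q : K}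
    (hq0 : q ≠ 0) (hPP : P * P = P) (hP : P = α • (P' * (c' • (1 : A) - S) * P'))
    (hP'P : P' * P = P) (hcomm : R * P' = P' * R) (hSP : S * P = (-q⁻¹) • P)
    (hbraid : R * S * R = S * R * S) (hHecke : R * R = (q - q⁻¹) • R + 1)
    (hc : c = α * c' * q) :
    R * (P * (c • (1 : A) - R) * P) = (-q⁻¹) • (P * (c • (1 : A) - R) * P) := by
  have hRP : R * P = P' * (R * P) := by
    rw [← mul_assoc, ← hcomm, mul_assoc, hP'P]
  have hPRP : P * (R * P) = α • (c' • (R * P) - P' * (S * (R * P))) := by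
    calc P * (R * P) = α • (P' * (c' • (1 : A) - S) * P') * (R * P) := by rw [← hP]
      _ = α • (P' * ((c' • (1 : A) - S) * (P' * (R * P)))) := by
        simp only [smul_mul_assoc, mul_assoc]
      _ = α • (c' • (R * P) - P' * (S * (R * P))) := by
        rw [← hRP, sub_mul, mul_sub, smul_mul_assoc, one_mul, mul_smul_comm, ← hRP]
  have hRRP : R * (R * P) = (q - q⁻¹) • (R * P) + P := by
    rw [← mul_assoc, hHecke, add_mul, one_mul, smul_mul_assoc]
  have hRSRP : R * (S * (R * P)) = (-q⁻¹) • (S * (R * P)) := by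
    have : R * (S * (R * P)) = S * (R * (S * P)) := by
      simpa only [mul_assoc] using congrArg (· * P) hbraid
    rw [this, hSP, mul_smul_comm, mul_smul_comm]
  have hRPRP : R * (P * (R * P)) =
      α • (c' • ((q - q⁻¹) • (R * P) + P) + q⁻¹ • (P' * (S * (R * P)))) := by
    rw [hPRP, mul_smul_comm, mul_sub, mul_smul_comm, hRRP, ← mul_assoc R P', hcomm, mul_assoc,
      hRSRP, mul_smul_comm, neg_smul, sub_neg_eq_add]
  have hX : P * (c • (1 : A) - R) * P = c • P - P * (R * P) := by
    rw [mul_sub, sub_mul, mul_smul_comm, mul_one, smul_mul_assoc, hPP, mul_assoc]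
  rw [hX, mul_sub, mul_smul_comm, hRPRP, hPRP, hc]
  have hq : q * q⁻¹ = 1 := mul_inv_cancel₀ hq0
  match_scalars
  · ring
  · linear_combination (α * c') * hq
  · ring

theorem commute_liftPos_skewSym {k N : ℕ} {q : K}
    {R : Matrix (Fin N × Fin N) (Fin N × Fin N) K}
    (hC : ∀ i j, i + 1 < j → Commute (liftPos k N R j) (liftPos k N R i)) (n : ℕ) :
    ∀ j, n < j → Commute (liftPos k N R j) (skewSym k N q R (n + 1)) := by
  induction n with
  | zero => exact fun j _ => Commute.one_right _
  | succ n ih =>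
    intro j hj
    have hP := ih j (by omega)
    exact Commute.smul_right (Commute.mul_right (Commute.mul_right hP
      (Commute.sub_right (Commute.smul_right (Commute.one_right _) _) (hC n j hj))) hP) _

theorem skewSym_absorb {k N : ℕ} {q : K} {R : Matrix (Fin N × Fin N) (Fin N × Fin N) K}
    (hq0 : q ≠ 0) (hqgen : ∀ n : ℕ, 0 < n → qInt q n ≠ 0)
    (hH : ∀ i, i + 1 < k → liftPos k N R i * liftPos k N R i =
      (q - q⁻¹) • liftPos k N R i + 1)
    (hB : ∀ i, i + 2 < k → liftPos k N R (i + 1) * liftPos k N R i * liftPos k N R (i + 1) =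
      liftPos k N R i * liftPos k N R (i + 1) * liftPos k N R i)
    (hC : ∀ i j, i + 1 < j → Commute (liftPos k N R j) (liftPos k N R i)) (n : ℕ) (hn : n < k) :
    skewSym k N q R (n + 1) * skewSym k N q R (n + 1) = skewSym k N q R (n + 1) ∧
    (∀ i, i < n → liftPos k N R i * skewSym k N q R (n + 1) =
      (-q⁻¹) • skewSym k N q R (n + 1)) ∧
    (∀ t, n = t + 1 → skewSym k N q R (t + 1) * skewSym k N q R (n + 1) =
      skewSym k N q R (n + 1)) := by
  induction n with
  | zero => simp [skewSym]
  | succ n ih =>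
    obtain ⟨hPP, hRP, hQP⟩ := ih (by omega)
    have h1 : qInt q 1 ≠ 0 := hqgen 1 one_pos
    have hn1 := hqgen (n + 1) (by omega)
    have hn2 := hqgen (n + 2) (by omega)
    have hdef : skewSym k N q R (n + 1 + 1) = (qInt q (n + 1) / qInt q (n + 2)) •
        (skewSym k N q R (n + 1) *
          ((q ^ (n + 1) / qInt q (n + 1)) • (1 : Matrix (Fin k → Fin N) (Fin k → Fin N) K) -
            liftPos k N R n) * skewSym k N q R (n + 1)) := rfl
    have hlast : liftPos k N R n * skewSym k N q R (n + 1 + 1) =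
        (-q⁻¹) • skewSym k N q R (n + 1 + 1) := by
      rw [hdef, mul_smul_comm, smul_comm (-q⁻¹)]
      congr 1
      cases n with
      | zero =>
        have hq : q * q⁻¹ = 1 := mul_inv_cancel₀ hq0
        simp only [skewSym, zero_add, qInt_one h1, pow_one, div_one, one_mul, mul_one, mul_sub,
          mul_smul_comm, hH 0 (by omega)]
        match_scalars
        · ring
        · linear_combination hq
      | succ t =>
        have ht1 := hqgen (t + 1) (by omega)
        refine fusion_absorb (P' := skewSym k N q R (t + 1)) (S := liftPos k N R t)
          (α := qInt q (t + 1) / qInt q (t + 2)) (c' := q ^ (t + 1) / qInt q (t + 1))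
          hq0 hPP rfl ?_ ?_ (hRP t (by omega)) (hB t (by omega)) (hH _ (by omega)) ?_
        · exact hQP t rfl
        · exact (commute_liftPos_skewSym hC t (t + 1) (by omega)).eq
        · field_simp
          ring
    have habs : ∀ i, i < n + 1 → liftPos k N R i * skewSym k N q R (n + 1 + 1) =
        (-q⁻¹) • skewSym k N q R (n + 1 + 1) := by
      intro i hi
      rcases Nat.lt_succ_iff_lt_or_eq.mp hi with hi | rfl
      · simp only [hdef, mul_smul_comm, ← mul_assoc, hRP i hi, smul_mul_assoc]
        rw [smul_comm]
      · exact hlast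
    have hPQ : skewSym k N q R (n + 1) * skewSym k N q R (n + 1 + 1) =
        skewSym k N q R (n + 1 + 1) := by
      simp only [hdef, mul_smul_comm, ← mul_assoc, hPP]
    refine ⟨?_, habs, ?_⟩
    · nth_rewrite 1 [hdef]
      rw [smul_mul_assoc, mul_assoc, mul_assoc, hPQ, sub_mul, hlast, smul_mul_assoc, one_mul,
        ← sub_smul, mul_smul_comm, hPQ, smul_smul]
      convert one_smul K _ using 2
      have hrec : q ^ (n + 1) + q⁻¹ * qInt q (n + 1) = qInt q (n + 2) :=
        (qInt_succ hq0 h1 (n + 1)).symm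
      rw [sub_neg_eq_add, div_mul_eq_mul_div, mul_add, mul_div_cancel₀ _ hn1,
        mul_comm (qInt q (n + 1)), hrec, div_self hn2]
    · rintro t ht
      obtain rfl : n = t := by omega
      exact hPQ

section Embedding

variable {n p k : Type*}

/-- The operator acting as `A` on the tensor factors in the range of `e`, and trivially on the
other ones. -/
def embedMat [DecidableEq n] [Fintype p] [Fintype k] [DecidableEq k] (e : p → k)
    (A : Matrix (p → n) (p → n) K) : Matrix (k → n) (k → n) K :=
  Matrix.of fun f g => if ∀ t, (∀ i, e i ≠ t) → f t = g t then A (f ∘ e) (g ∘ e) else 0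

theorem embedMat_apply [DecidableEq n] [Fintype p] [Fintype k] [DecidableEq k] (e : p → k)
    (A : Matrix (p → n) (p → n) K) (f g : k → n) :
    embedMat e A f g =
      if ∀ t, (∀ i, e i ≠ t) → f t = g t then A (f ∘ e) (g ∘ e) else 0 := rfl

theorem extend_comp_eq {e : p → k} {f h : k → n} (hf : ∀ t, (∀ i, e i ≠ t) → f t = h t)
    (he : Function.Injective e) : Function.extend e (h ∘ e) f = h := by
  funext t
  by_cases ht : ∃ i, e i = t
  · obtain ⟨i, rfl⟩ := ht
    rw [he.extend_apply, Function.comp_apply]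
  · rw [Function.extend_apply' _ _ _ ht, hf t (by simpa using ht)]

theorem extend_apply_off (e : p → k) (x : p → n) (f : k → n) (t : k) (ht : ∀ i, e i ≠ t) :
    Function.extend e x f t = f t :=
  Function.extend_apply' _ _ _ (by simpa using ht)

theorem sum_agree_off [Fintype n] [DecidableEq n] [Fintype p] [DecidableEq p] [Fintype k]
    [DecidableEq k]
    {e : p → k} (he : Function.Injective e) (f : k → n) (F : (k → n) → K) :
    (∑ h, if ∀ t, (∀ i, e i ≠ t) → f t = h t then F h else 0) =
      ∑ x : p → n, F (Function.extend e x f) := by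
  rw [← Finset.sum_filter]
  refine Finset.sum_nbij' (fun h => h ∘ e) (fun x => Function.extend e x f) ?_ ?_ ?_ ?_ ?_
  · simp
  · intro x _
    simp only [Finset.mem_filter, Finset.mem_univ, true_and]
    exact fun t ht => (extend_apply_off e x f t ht).symm
  · intro h hh
    exact extend_comp_eq (Finset.mem_filter.mp hh).2 he
  · intro x _
    exact Function.extend_comp he x f
  · intro h hh
    rw [extend_comp_eq (Finset.mem_filter.mp hh).2 he]

theorem embedMat_mul_apply [Fintype n] [DecidableEq n] [Fintype p] [DecidableEq p] [Fintype k]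
    [DecidableEq k]
    {e : p → k} (he : Function.Injective e)
    (A : Matrix (p → n) (p → n) K) (X : Matrix (k → n) (k → n) K) (f g : k → n) :
    (embedMat e A * X) f g = ∑ x, A (f ∘ e) x * X (Function.extend e x f) g := by
  simp only [Matrix.mul_apply, embedMat_apply, ite_mul, zero_mul]
  rw [sum_agree_off he]
  simp only [Function.extend_comp he]

theorem mul_embedMat_apply [Fintype n] [DecidableEq n] [Fintype p] [DecidableEq p] [Fintype k]
    [DecidableEq k]
    {e : p → k} (he : Function.Injective e)
    (A : Matrix (p → n) (p → n) K) (X : Matrix (k → n) (k → n) K) (f g : k → n) :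
    (X * embedMat e A) f g = ∑ x, X f (Function.extend e x g) * A x (g ∘ e) := by
  simp only [Matrix.mul_apply, embedMat_apply, mul_ite, mul_zero]
  have := sum_agree_off he g (fun h => X f h * A (h ∘ e) (g ∘ e))
  simp only [Function.extend_comp he] at this
  rw [← this]
  simp only [eq_comm]

theorem embedMat_mul [Fintype n] [DecidableEq n] [Fintype p] [DecidableEq p] [Fintype k]
    [DecidableEq k]
    {e : p → k} (he : Function.Injective e)
    (A B : Matrix (p → n) (p → n) K) :
    embedMat e (A * B) = embedMat e A * embedMat e B := by
  ext f g
  have hiff : ∀ x, (∀ t, (∀ i, e i ≠ t) → Function.extend e x f t = g t) ↔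
      ∀ t, (∀ i, e i ≠ t) → f t = g t := fun x =>
    forall₂_congr fun t ht => by rw [extend_apply_off e x f t ht]
  rw [embedMat_mul_apply he]
  simp only [embedMat_apply, hiff, Function.extend_comp he, Matrix.mul_apply]
  split_ifs <;> simp

theorem embedMat_one [DecidableEq n] [Fintype p] [Fintype k] [DecidableEq k]
    {e : p → k} : embedMat e (1 : Matrix (p → n) (p → n) K) = 1 := by
  ext f g
  rw [embedMat_apply]
  by_cases hfg : f = g
  · subst hfg
    simp only [implies_true, if_true, Matrix.one_apply_eq]
  · rw [Matrix.one_apply_ne hfg]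
    split_ifs with h
    · refine Matrix.one_apply_ne fun hc => hfg (funext fun t => ?_)
      by_cases ht : ∃ i, e i = t
      · obtain ⟨i, rfl⟩ := ht
        exact congrFun hc i
      · exact h t (by simpa using ht)
    · rfl

theorem embedMat_smul [DecidableEq n] [Fintype p] [Fintype k] [DecidableEq k]
    (e : p → k) (c : K) (A : Matrix (p → n) (p → n) K) :
    embedMat e (c • A) = c • embedMat e A := by
  ext f g
  simp [embedMat_apply]

theorem embedMat_add [DecidableEq n] [Fintype p] [Fintype k] [DecidableEq k]
    (e : p → k) (A B : Matrix (p → n) (p → n) K) :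
    embedMat e (A + B) = embedMat e A + embedMat e B := by
  ext f g
  simp only [embedMat_apply, Matrix.add_apply]
  split_ifs <;> simp

theorem embedMat_sub [DecidableEq n] [Fintype p] [Fintype k] [DecidableEq k]
    (e : p → k) (A B : Matrix (p → n) (p → n) K) :
    embedMat e (A - B) = embedMat e A - embedMat e B := by
  ext f g
  simp only [embedMat_apply, Matrix.sub_apply]
  split_ifs <;> simp

theorem embedMat_embedMat [DecidableEq n] [Fintype p] [Fintype k] [DecidableEq k]
    {l : Type*} [Fintype l] [DecidableEq l] {e : p → k} {e' : k → l}
    (he' : Function.Injective e') (A : Matrix (p → n) (p → n) K) :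
    embedMat e' (embedMat e A) = embedMat (e' ∘ e) A := by
  ext f g
  simp only [embedMat_apply, ← ite_and]
  refine if_congr ⟨?_, ?_⟩ rfl rfl
  · rintro ⟨h1, h2⟩ t ht
    by_cases hs : ∃ j, e' j = t
    · obtain ⟨j, rfl⟩ := hs
      exact h2 j fun i hi => ht i (by simp [hi])
    · exact h1 t (by simpa using hs)
  · intro h
    exact ⟨fun t ht => h t fun i => ht (e i),
      fun j hj => h (e' j) fun i hi => hj i (he' hi)⟩

theorem embedMat_commute [Fintype n] [DecidableEq n] [Fintype p] [DecidableEq p] [Fintype k]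
    [DecidableEq k]
    {p' : Type*} [Fintype p'] [DecidableEq p'] {e : p → k} {e' : p' → k}
    (he : Function.Injective e) (hdisj : ∀ i j, e i ≠ e' j)
    (A : Matrix (p → n) (p → n) K) (B : Matrix (p' → n) (p' → n) K) :
    Commute (embedMat e A) (embedMat e' B) := by
  ext f g
  rw [embedMat_mul_apply he, mul_embedMat_apply he]
  simp only [embedMat_apply]
  have hcomp : ∀ (x : p → n) (h : k → n), Function.extend e x h ∘ e' = h ∘ e' := fun x h =>
    funext fun j => extend_apply_off e x h _ fun i => hdisj i j
  simp only [hcomp, mul_ite, ite_mul, mul_zero, zero_mul]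
  have h1 : ∀ x, (∀ t, (∀ j, e' j ≠ t) → Function.extend e x f t = g t) ↔
      x = g ∘ e ∧ ∀ t, (∀ i, e i ≠ t) → (∀ j, e' j ≠ t) → f t = g t := by
    intro x
    constructor
    · intro h
      refine ⟨funext fun i => ?_, fun t ht ht' => ?_⟩
      · rw [Function.comp_apply, ← h (e i) fun j hj => hdisj i j hj.symm, he.extend_apply]
      · rw [← h t ht', extend_apply_off e x f t ht]
    · rintro ⟨rfl, h⟩ t ht'
      by_cases ht : ∃ i, e i = t
      · obtain ⟨i, rfl⟩ := ht
        rw [he.extend_apply, Function.comp_apply]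
      · have ht : ∀ i, e i ≠ t := by simpa using ht
        rw [extend_apply_off e _ f t ht, h t ht ht']
  have h2 : ∀ x, (∀ t, (∀ j, e' j ≠ t) → f t = Function.extend e x g t) ↔
      x = f ∘ e ∧ ∀ t, (∀ i, e i ≠ t) → (∀ j, e' j ≠ t) → f t = g t := by
    intro x
    constructor
    · intro h
      refine ⟨funext fun i => ?_, fun t ht ht' => ?_⟩
      · rw [Function.comp_apply, h (e i) fun j hj => hdisj i j hj.symm, he.extend_apply]
      · rw [h t ht', extend_apply_off e x g t ht]
    · rintro ⟨rfl, h⟩ t ht'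
      by_cases ht : ∃ i, e i = t
      · obtain ⟨i, rfl⟩ := ht
        rw [he.extend_apply, Function.comp_apply]
      · have ht : ∀ i, e i ≠ t := by simpa using ht
        rw [extend_apply_off e _ g t ht, h t ht ht']
  simp only [h1, h2, ite_and, Finset.sum_ite_eq', Finset.mem_univ, if_true, mul_comm]

end Embedding

/-- The matrix `R` with its row and column indices regarded as functions on two positions. -/
def pairMat {N : ℕ} (R : Matrix (Fin N × Fin N) (Fin N × Fin N) K) :
    Matrix (Fin 2 → Fin N) (Fin 2 → Fin N) K :=
  R.submatrix (finTwoArrowEquiv (Fin N)) (finTwoArrowEquiv (Fin N))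

theorem liftPos_eq_embedMat {k N i : ℕ} (R : Matrix (Fin N × Fin N) (Fin N × Fin N) K)
    (h : i + 1 < k) : liftPos k N R i =
      embedMat ![(⟨i, Nat.lt_of_succ_lt h⟩ : Fin k), ⟨i + 1, h⟩] (pairMat R) := by
  ext f g
  rw [liftPos, dif_pos h, embedMat_apply, Matrix.of_apply, Finset.prod_ite_zero]
  have hiff : (∀ t ∈ Finset.univ.filter (fun t : Fin k => (t : ℕ) ≠ i ∧ (t : ℕ) ≠ i + 1),
      f t = g t) ↔ ∀ t, (∀ j, ![(⟨i, Nat.lt_of_succ_lt h⟩ : Fin k), ⟨i + 1, h⟩] j ≠ t) →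
        f t = g t := by
    simp [Fin.forall_fin_two, Fin.ext_iff, eq_comm]
  simp only [hiff, Finset.prod_const_one, mul_ite, mul_one, mul_zero]
  simp [pairMat]

theorem injective_consecutive {k i : ℕ} (h : i + 1 < k) :
    Function.Injective ![(⟨i, Nat.lt_of_succ_lt h⟩ : Fin k), ⟨i + 1, h⟩] := by
  intro a b
  fin_cases a <;> fin_cases b <;> simp

theorem embedMat_liftPos {p k N i j : ℕ} (R : Matrix (Fin N × Fin N) (Fin N × Fin N) K)
    {e : Fin p → Fin k} (he : Function.Injective e) (hi : i + 1 < p)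
    (h0 : (e ⟨i, Nat.lt_of_succ_lt hi⟩ : ℕ) = j) (h1 : (e ⟨i + 1, hi⟩ : ℕ) = j + 1) :
    embedMat e (liftPos p N R i) = liftPos k N R j := by
  have hj : j + 1 < k := h1 ▸ (e ⟨i + 1, hi⟩).isLt
  rw [liftPos_eq_embedMat R hi, liftPos_eq_embedMat R hj, embedMat_embedMat he]
  congr 1
  funext a
  fin_cases a <;> simp [Fin.ext_iff, h0, h1]

theorem liftPos_hecke {N : ℕ} {R : Matrix (Fin N × Fin N) (Fin N × Fin N) K} {c : K}
    (hHecke : R * R = c • R + 1) {k i : ℕ} (h : i + 1 < k) :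
    liftPos k N R i * liftPos k N R i = c • liftPos k N R i + 1 := by
  have hpair : pairMat R * pairMat R = c • pairMat R + 1 := by
    have h1 : (1 : Matrix (Fin N × Fin N) (Fin N × Fin N) K).submatrix
        (finTwoArrowEquiv (Fin N)) (finTwoArrowEquiv (Fin N)) = 1 :=
      Matrix.submatrix_one_equiv _
    rw [pairMat, Matrix.submatrix_mul_equiv, hHecke, ← h1]
    rfl
  rw [liftPos_eq_embedMat R h, ← embedMat_mul (injective_consecutive h), hpair, embedMat_add,
    embedMat_smul, embedMat_one]

theorem liftPos_braid {N : ℕ} {R : Matrix (Fin N × Fin N) (Fin N × Fin N) K}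
    (hbraid : liftPos 3 N R 0 * liftPos 3 N R 1 * liftPos 3 N R 0 =
      liftPos 3 N R 1 * liftPos 3 N R 0 * liftPos 3 N R 1) {k i : ℕ} (h : i + 2 < k) :
    liftPos k N R i * liftPos k N R (i + 1) * liftPos k N R i =
      liftPos k N R (i + 1) * liftPos k N R i * liftPos k N R (i + 1) := by
  let e : Fin 3 → Fin k := fun t => ⟨i + t, by omega⟩
  have he : Function.Injective e := fun a b hab => by
    simpa [e, Fin.ext_iff] using hab
  rw [← embedMat_liftPos R he (i := 0) (j := i) (by omega) rfl rfl,
    ← embedMat_liftPos R he (i := 1) (j := i + 1) (by omega) rfl rfl]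
  simp only [← embedMat_mul he, hbraid]

theorem liftPos_commute {N : ℕ} (R : Matrix (Fin N × Fin N) (Fin N × Fin N) K) {k i j : ℕ}
    (h : i + 1 < j) : Commute (liftPos k N R j) (liftPos k N R i) := by
  by_cases hj : j + 1 < k
  · have hi : i + 1 < k := by omega
    rw [liftPos_eq_embedMat R hj, liftPos_eq_embedMat R hi]
    refine embedMat_commute (injective_consecutive hj) ?_ _ _
    intro a b
    fin_cases a <;> fin_cases b <;> simp <;> omega
  · rw [liftPos, dif_neg hj]
    exact Commute.one_left _

theorem embedMat_skewSym {k N : ℕ} {q : K} (R : Matrix (Fin N × Fin N) (Fin N × Fin N) K)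
    (n : ℕ) (hn : n < k) :
    embedMat (Fin.castSucc (n := k)) (skewSym k N q R (n + 1)) =
      skewSym (k + 1) N q R (n + 1) := by
  have he := Fin.castSucc_injective k
  induction n with
  | zero => exact embedMat_one
  | succ n ih =>
    simp only [skewSym, embedMat_smul, embedMat_mul he, embedMat_sub, embedMat_one]
    rw [ih (by omega), embedMat_liftPos R he hn (j := n) rfl rfl]

/-- The `R`-trace, with weight `C`, over the last tensor factor. -/
def lastTrace {k N : ℕ} (C : Matrix (Fin N) (Fin N) K)
    (X : Matrix (Fin (k + 1) → Fin N) (Fin (k + 1) → Fin N) K) :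
    Matrix (Fin k → Fin N) (Fin k → Fin N) K :=
  Matrix.of fun f g => ∑ a, ∑ b, X (Fin.snoc f a) (Fin.snoc g b) * C b a

section LastTrace

variable {k N : ℕ} (C : Matrix (Fin N) (Fin N) K)

theorem snoc_comp_castSucc (f : Fin k → Fin N) (a : Fin N) :
    (Fin.snoc f a : Fin (k + 1) → Fin N) ∘ Fin.castSucc = f := by
  funext i
  simp

theorem extend_castSucc_snoc (x f : Fin k → Fin N) (a : Fin N) :
    Function.extend Fin.castSucc x (Fin.snoc f a : Fin (k + 1) → Fin N) = Fin.snoc x a := by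
  funext t
  refine Fin.lastCases ?_ (fun i => ?_) t
  · rw [extend_apply_off _ _ _ _ Fin.castSucc_ne_last, Fin.snoc_last, Fin.snoc_last]
  · rw [(Fin.castSucc_injective k).extend_apply, Fin.snoc_castSucc]

theorem lastTrace_embedMat_mul (A : Matrix (Fin k → Fin N) (Fin k → Fin N) K)
    (X : Matrix (Fin (k + 1) → Fin N) (Fin (k + 1) → Fin N) K) :
    lastTrace C (embedMat Fin.castSucc A * X) = A * lastTrace C X := by
  ext f g
  simp only [lastTrace, Matrix.of_apply, embedMat_mul_apply (Fin.castSucc_injective k),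
    snoc_comp_castSucc, extend_castSucc_snoc, Matrix.mul_apply, Finset.sum_mul, Finset.mul_sum,
    mul_assoc]
  rw [Finset.sum_comm_cycle]

theorem lastTrace_mul_embedMat (A : Matrix (Fin k → Fin N) (Fin k → Fin N) K)
    (X : Matrix (Fin (k + 1) → Fin N) (Fin (k + 1) → Fin N) K) :
    lastTrace C (X * embedMat Fin.castSucc A) = lastTrace C X * A := by
  ext f g
  simp only [lastTrace, Matrix.of_apply, mul_embedMat_apply (Fin.castSucc_injective k),
    snoc_comp_castSucc, extend_castSucc_snoc, Matrix.mul_apply, Finset.sum_mul, mul_right_comm]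
  rw [Finset.sum_comm_cycle]

theorem lastTrace_sub (X Y : Matrix (Fin (k + 1) → Fin N) (Fin (k + 1) → Fin N) K) :
    lastTrace C (X - Y) = lastTrace C X - lastTrace C Y := by
  ext f g
  simp [lastTrace, sub_mul]

theorem lastTrace_smul (c : K) (X : Matrix (Fin (k + 1) → Fin N) (Fin (k + 1) → Fin N) K) :
    lastTrace C (c • X) = c • lastTrace C X := by
  ext f g
  simp [lastTrace, mul_assoc, Finset.mul_sum]

theorem lastTrace_zero :
    lastTrace C (0 : Matrix (Fin (k + 1) → Fin N) (Fin (k + 1) → Fin N) K) = 0 := by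
  ext f g
  simp [lastTrace]

theorem lastTrace_one :
    lastTrace C (1 : Matrix (Fin (k + 1) → Fin N) (Fin (k + 1) → Fin N) K) = C.trace • 1 := by
  ext f g
  by_cases hfg : f = g
  · simp [lastTrace, Matrix.one_apply, Fin.snoc_inj, hfg, Matrix.trace]
  · simp [lastTrace, Matrix.one_apply, Fin.snoc_inj, hfg]

theorem lastTrace_liftPos {R : Matrix (Fin N × Fin N) (Fin N × Fin N) K}
    (hRC : ∀ i i', ∑ a, ∑ b, R (i, a) (i', b) * C b a = if i = i' then 1 else 0) :
    lastTrace C (liftPos (k + 2) N R k) = 1 := by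
  ext f g
  have hentry : ∀ a b, liftPos (k + 2) N R k (Fin.snoc f a) (Fin.snoc g b) =
      if ∀ i : Fin k, f i.castSucc = g i.castSucc then
        R (f (Fin.last k), a) (g (Fin.last k), b) else 0 := by
    intro a b
    have h0 : (⟨k, by omega⟩ : Fin (k + 2)) = (Fin.last k).castSucc := rfl
    have h1 : (⟨k + 1, by omega⟩ : Fin (k + 2)) = Fin.last (k + 1) := rfl
    rw [liftPos, dif_pos (by omega), Matrix.of_apply, Finset.prod_ite_zero]
    have hiff : (∀ t ∈ Finset.univ.filter (fun t : Fin (k + 2) => (t : ℕ) ≠ k ∧ (t : ℕ) ≠ k + 1),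
        (Fin.snoc f a : Fin (k + 2) → Fin N) t = (Fin.snoc g b : Fin (k + 2) → Fin N) t) ↔
        ∀ i : Fin k, f i.castSucc = g i.castSucc := by
      simp only [Finset.mem_filter, Finset.mem_univ, true_and]
      constructor
      · intro h i
        have := h i.castSucc.castSucc
          ⟨by simpa using i.isLt.ne, by simp; omega⟩
        simpa only [Fin.snoc_castSucc] using this
      · intro h t ht
        obtain ⟨i, rfl⟩ : ∃ i : Fin k, t = i.castSucc.castSucc :=
          ⟨⟨t, by omega⟩, rfl⟩
        simpa only [Fin.snoc_castSucc] using h i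
    simp only [hiff, Finset.prod_const_one, mul_ite, mul_one, mul_zero, h0, h1, Fin.snoc_castSucc,
      Fin.snoc_last]
  simp only [lastTrace, Matrix.of_apply, hentry, ite_mul, zero_mul]
  have hfg : f = g ↔ (∀ i : Fin k, f i.castSucc = g i.castSucc) ∧
      f (Fin.last k) = g (Fin.last k) := by
    rw [funext_iff, Fin.forall_fin_succ', and_comm]
  by_cases h : ∀ i : Fin k, f i.castSucc = g i.castSucc
  · simp only [h, implies_true, if_true, hRC, Matrix.one_apply, hfg, true_and]
  · simp only [h, if_false, Finset.sum_const_zero, Matrix.one_apply, hfg, false_and]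

end LastTrace

theorem lastTrace_skewSym {N : ℕ} {R : Matrix (Fin N × Fin N) (Fin N × Fin N) K}
    {C : Matrix (Fin N) (Fin N) K} {q : K}
    (hq0 : q ≠ 0) (hqgen : ∀ n : ℕ, 0 < n → qInt q n ≠ 0)
    (hbraid : liftPos 3 N R 0 * liftPos 3 N R 1 * liftPos 3 N R 0 =
      liftPos 3 N R 1 * liftPos 3 N R 0 * liftPos 3 N R 1)
    (hHecke : R * R = (q - q⁻¹) • R + 1)
    (hRC : ∀ i i', ∑ a, ∑ b, R (i, a) (i', b) * C b a = if i = i' then 1 else 0) (M : ℕ) :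
    lastTrace C (skewSym (M + 1) N q R (M + 1)) =
      ((q ^ M * C.trace - qInt q M) / qInt q (M + 1)) • skewSym M N q R M := by
  have h1 := hqgen 1 one_pos
  cases M with
  | zero =>
    simp only [skewSym, lastTrace_one, zero_add, qInt_one h1]
    simp [qInt]
  | succ n =>
    have hn1 := hqgen (n + 1) (by omega)
    have hn2 := hqgen (n + 2) (by omega)
    have hPP := (skewSym_absorb hq0 hqgen (fun _ h => liftPos_hecke hHecke h)
      (fun _ h => (liftPos_braid hbraid h).symm) (fun _ _ h => liftPos_commute R h)
      n (Nat.lt_succ_self n)).1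
    rw [skewSym, ← embedMat_skewSym R n (Nat.lt_succ_self n), lastTrace_smul,
      lastTrace_mul_embedMat, lastTrace_embedMat_mul, lastTrace_sub, lastTrace_smul,
      lastTrace_one, lastTrace_liftPos C hRC, smul_smul, mul_sub, sub_mul, mul_smul_comm,
      mul_one, smul_mul_assoc, hPP]
    match_scalars
    field_simp

theorem trace_eq_of_skewSym_eq_zero {N m : ℕ} {R : Matrix (Fin N × Fin N) (Fin N × Fin N) K}
    {C : Matrix (Fin N) (Fin N) K} {q : K}
    (hq0 : q ≠ 0) (hqgen : ∀ n : ℕ, 0 < n → qInt q n ≠ 0)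
    (hbraid : liftPos 3 N R 0 * liftPos 3 N R 1 * liftPos 3 N R 0 =
      liftPos 3 N R 1 * liftPos 3 N R 0 * liftPos 3 N R 1)
    (hHecke : R * R = (q - q⁻¹) • R + 1)
    (hRC : ∀ i i', ∑ a, ∑ b, R (i, a) (i', b) * C b a = if i = i' then 1 else 0)
    (hne : skewSym m N q R m ≠ 0) (htriv : skewSym (m + 1) N q R (m + 1) = 0) :
    C.trace = (q ^ m)⁻¹ * qInt q m := by
  have h := lastTrace_skewSym hq0 hqgen hbraid hHecke hRC m
  rw [htriv, lastTrace_zero, eq_comm, smul_eq_zero, or_iff_left hne,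
    div_eq_zero_iff, or_iff_left (hqgen _ m.succ_pos), sub_eq_zero] at h
  rw [← h, inv_mul_cancel_left₀ (pow_ne_zero m hq0)]

/-- The `R`-trace, with weight `C`, over the last `j` tensor factors. -/
def lastTraces {k N : ℕ} (j : ℕ) (C : Matrix (Fin N) (Fin N) K)
    (X : Matrix (Fin (k + j) → Fin N) (Fin (k + j) → Fin N) K) :
    Matrix (Fin k → Fin N) (Fin k → Fin N) K :=
  Matrix.of fun f g => ∑ a : Fin j → Fin N, ∑ b : Fin j → Fin N,
    X (Fin.append f a) (Fin.append g b) * ∏ t, C (b t) (a t)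

theorem lastTraces_zero {k N : ℕ} (C : Matrix (Fin N) (Fin N) K)
    (X : Matrix (Fin k → Fin N) (Fin k → Fin N) K) : lastTraces 0 C X = X := by
  ext f g
  simp [lastTraces, Fin.append_elim0, Subsingleton.elim (default : Fin 0 → Fin N) Fin.elim0]

theorem lastTraces_smul {k N : ℕ} (j : ℕ) (C : Matrix (Fin N) (Fin N) K) (c : K)
    (X : Matrix (Fin (k + j) → Fin N) (Fin (k + j) → Fin N) K) :
    lastTraces j C (c • X) = c • lastTraces j C X := by
  ext f g
  simp [lastTraces, mul_assoc, Finset.mul_sum]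

theorem lastTraces_succ {k N : ℕ} (j : ℕ) (C : Matrix (Fin N) (Fin N) K)
    (X : Matrix (Fin (k + (j + 1)) → Fin N) (Fin (k + (j + 1)) → Fin N) K) :
    lastTraces (j + 1) C X = lastTraces j C (lastTrace (k := k + j) C X) := by
  ext f g
  have hsum : ∀ F : (Fin (j + 1) → Fin N) → K,
      ∑ a, F a = ∑ a : Fin j → Fin N, ∑ x : Fin N, F (Fin.snoc a x) := by
    intro F
    rw [← (Fin.snocEquiv fun _ => Fin N).sum_comp F, Fintype.sum_prod_type_right]
    rfl
  simp only [lastTraces, lastTrace, Matrix.of_apply, hsum, Fin.append_snoc,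
    Fin.prod_univ_castSucc, Fin.snoc_castSucc, Fin.snoc_last, Finset.sum_mul]
  refine Finset.sum_congr rfl fun a _ => ?_
  rw [Finset.sum_comm]
  refine Finset.sum_congr rfl fun b _ => Finset.sum_congr rfl fun x _ =>
    Finset.sum_congr rfl fun y _ => ?_
  ring

theorem lastTraces_skewSym {N m : ℕ} {R : Matrix (Fin N × Fin N) (Fin N × Fin N) K}
    {C : Matrix (Fin N) (Fin N) K} {q : K}
    (hq0 : q ≠ 0) (hqgen : ∀ n : ℕ, 0 < n → qInt q n ≠ 0)
    (hlast : ∀ M, lastTrace C (skewSym (M + 1) N q R (M + 1)) =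
      ((q ^ M * C.trace - qInt q M) / qInt q (M + 1)) • skewSym M N q R M)
    (htr : C.trace = (q ^ m)⁻¹ * qInt q m) (k j : ℕ) :
    ∀ r, k + j + r = m → lastTraces j C (skewSym (k + j) N q R (k + j)) =
      ((q ^ (m * j))⁻¹ * (qFact q k * qFact q (j + r) / (qFact q r * qFact q (k + j)))) •
        skewSym k N q R k := by
  have hfact := qFact_ne_zero hqgen
  induction j with
  | zero =>
    intro r _
    have hk := hfact k
    have hr := hfact r
    refine (lastTraces_zero C _).trans ?_
    rw [Nat.zero_add, mul_comm (qFact q r)]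
    simp only [Nat.add_zero, div_self (mul_ne_zero hk hr), Nat.mul_zero, pow_zero, inv_one,
      one_mul, one_smul]
  | succ j ih =>
    intro r hr
    have h := hlast (k + j)
    rw [htr, show m = k + j + (r + 1) by omega, pow_mul_qInt_sub hq0,
      ← show m = k + j + (r + 1) by omega] at h
    rw [lastTraces_succ]
    refine (congrArg (lastTraces j C) h).trans ?_
    rw [lastTraces_smul, ih (r + 1) (by omega), smul_smul]
    congr 1
    have h1 := hfact r
    have h2 := hfact (k + j)
    have h3 := hqgen (k + j + 1) (by omega)
    have h4 := hqgen (r + 1) (by omega)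
    rw [show k + (j + 1) = k + j + 1 by omega, show j + 1 + r = j + (r + 1) by omega, mul_add,
      mul_one, pow_add]
    simp only [qFact]
    field_simp

theorem joinFin_add {k j N : ℕ} (f : Fin k → Fin N) (a : Fin j → Fin N) :
    joinFin (Nat.le_add_right k j) f (fun t => a (Fin.cast (Nat.add_sub_cancel_left k j) t)) =
      Fin.append f a := by
  funext t
  refine Fin.addCases (fun i => ?_) (fun i => ?_) t
  · simp [joinFin]
  · simp [joinFin]

theorem sum_joinFin_eq_lastTraces {k j N : ℕ} (C : Matrix (Fin N) (Fin N) K)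
    (X : Matrix (Fin (k + j) → Fin N) (Fin (k + j) → Fin N) K) (f g : Fin k → Fin N) :
    (∑ a : Fin (k + j - k) → Fin N, ∑ b : Fin (k + j - k) → Fin N,
      X (joinFin (Nat.le_add_right k j) f a) (joinFin (Nat.le_add_right k j) g b) *
        ∏ t, C (b t) (a t)) = lastTraces j C X f g := by
  have hj : k + j - k = j := Nat.add_sub_cancel_left k j
  let e : (Fin j → Fin N) ≃ (Fin (k + j - k) → Fin N) :=
    Equiv.arrowCongr (finCongr hj.symm) (Equiv.refl _)
  rw [← e.sum_comp]
  refine Finset.sum_congr rfl fun a _ => ?_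
  rw [← e.sum_comp]
  refine Finset.sum_congr rfl fun b _ => ?_
  rw [← joinFin_add f a, ← joinFin_add g b, ← (finCongr hj).prod_comp]
  rfl

/-- partial R-traces of the top skew-symmetrizer:
Tr_{R(k+1…m)}(P⁽ᵐ⁾) = q^{−m(m−k)} (k_q!(m−k)_q!/m_q!) P⁽ᵏ⁾ for 0 ≤ k ≤ m−1,
and in particular Tr_{R(1…m)}(P⁽ᵐ⁾) = q^{−m²}. -/
theorem partial_trace_skewSym {N m : ℕ}
    (R Ψ : Matrix (Fin N × Fin N) (Fin N × Fin N) K)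
    (C : Matrix (Fin N) (Fin N) K) (q : K)
    (hq0 : q ≠ 0) (hqgen : ∀ n : ℕ, 0 < n → qInt q n ≠ 0)
    (hbraid : liftPos 3 N R 0 * liftPos 3 N R 1 * liftPos 3 N R 0 =
      liftPos 3 N R 1 * liftPos 3 N R 0 * liftPos 3 N R 1)
    (hHecke : R * R = (q - q⁻¹) • R + 1)
    (hΨ : ∀ i p q' k : Fin N,
      (∑ j : Fin N, ∑ l : Fin N, R (i, j) (k, l) * Ψ (l, p) (j, q')) =
        (if i = q' then 1 else 0) * (if p = k then 1 else 0))
    (hCdef : ∀ i j : Fin N, C i j = ∑ s : Fin N, Ψ (i, s) (j, s))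
    (hrank : Matrix.rank (skewSym m N q R m) = 1)
    (htriv : skewSym (m + 1) N q R (m + 1) = 0) :
    (∀ k : ℕ, ∀ hk : k < m, ∀ f g : Fin k → Fin N,
      (∑ a : Fin (m - k) → Fin N, ∑ b : Fin (m - k) → Fin N,
        skewSym m N q R m (joinFin (Nat.le_of_lt hk) f a) (joinFin (Nat.le_of_lt hk) g b) *
          ∏ t, C (b t) (a t)) =
      (q ^ (m * (m - k)))⁻¹ * (qFact q k * qFact q (m - k) / qFact q m) *
        skewSym k N q R k f g) ∧
    (∑ I : Fin m → Fin N, ∑ J : Fin m → Fin N,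
      skewSym m N q R m I J * ∏ t, C (J t) (I t)) = (q ^ (m * m))⁻¹ := by
  have hRC : ∀ i i', ∑ a, ∑ b, R (i, a) (i', b) * C b a = if i = i' then 1 else 0 := by
    intro i i'
    simp only [hCdef, Finset.mul_sum]
    rw [Finset.sum_comm_cycle]
    simp only [hΨ]
    simp
  have hne : skewSym m N q R m ≠ 0 := by
    intro h
    simp [h] at hrank
  have htr := trace_eq_of_skewSym_eq_zero hq0 hqgen hbraid hHecke hRC hne htriv
  have hmain : ∀ k : ℕ, ∀ hk : k ≤ m, ∀ f g : Fin k → Fin N,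
      (∑ a : Fin (m - k) → Fin N, ∑ b : Fin (m - k) → Fin N,
        skewSym m N q R m (joinFin hk f a) (joinFin hk g b) * ∏ t, C (b t) (a t)) =
      (q ^ (m * (m - k)))⁻¹ * (qFact q k * qFact q (m - k) / qFact q m) *
        skewSym k N q R k f g := by
    intro k hk f g
    have h := fun j => lastTraces_skewSym hq0 hqgen
      (lastTrace_skewSym hq0 hqgen hbraid hHecke hRC) htr k j 0
    clear hrank htriv hne htr
    obtain ⟨j, rfl⟩ := Nat.exists_eq_add_of_le hk
    rw [sum_joinFin_eq_lastTraces, h j rfl, Nat.add_sub_cancel_left]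
    simp [qFact]
  refine ⟨fun k hk => hmain k hk.le, ?_⟩
  have h := hmain 0 (Nat.zero_le m) Fin.elim0 Fin.elim0
  have hjoin : ∀ I : Fin m → Fin N, joinFin (Nat.zero_le m) Fin.elim0 I = I := fun I => rfl
  simp only [Nat.sub_zero, hjoin] at h
  rw [h]
  simp [qFact, skewSym, qFact_ne_zero hqgen m]
end

section
/- In the Reflection Equation algebra L(R) with skew-invertible Hecke symmetry R, the power sum p₃(L) = Tr_{R(123)}(R₂R₁ L_{1̄}L_{2̄}L_{3̄}) equals Tr_R(L³), the R-trace of the ordinary third matrix power of L. -/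
open Matrix BigOperators

variable {K : Type*} [Field K]

def embed1 (m N : ℕ) (hm : 0 < m) {A : Type*} [Ring A]
    (L : Matrix (Fin N) (Fin N) A) :
    Matrix (Fin m → Fin N) (Fin m → Fin N) A :=
  Matrix.of fun f g =>
    L (f ⟨0, hm⟩) (g ⟨0, hm⟩) *
      (if ∀ t : Fin m, (t : ℕ) ≠ 0 → f t = g t then 1 else 0)

def Lbar (m N : ℕ) (hm : 0 < m) {A : Type*} [Ring A] [Algebra K A]
    (R Rinv : Matrix (Fin N × Fin N) (Fin N × Fin N) K)
    (L : Matrix (Fin N) (Fin N) A) :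
    ℕ → Matrix (Fin m → Fin N) (Fin m → Fin N) A
  | 0 => embed1 m N hm L
  | (n + 1) =>
      (liftPos m N R n).map (algebraMap K A) *
        Lbar m N hm R Rinv L n *
        (liftPos m N Rinv n).map (algebraMap K A)

section RTrace

variable {m n A : Type*} [Ring A]

/-- The weighted partial trace over the second tensor factor. -/
def partialTr [Fintype n] (c : Matrix n n A) (M : Matrix (m × n) (m × n) A) : Matrix m m A :=
  Matrix.of fun a b => ∑ x, ∑ y, M (a, x) (b, y) * c y x

/-- The action of a matrix on the first tensor factor. -/
def onFst (n : Type*) [DecidableEq n] (X : Matrix m m A) : Matrix (m × n) (m × n) A :=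
  Matrix.of fun p r => X p.1 r.1 * (if p.2 = r.2 then 1 else 0)

/-- The action of a matrix on the last two of three tensor factors. -/
def onLast [DecidableEq n] (S : Matrix (n × n) (n × n) A) : Matrix ((n × n) × n) ((n × n) × n) A :=
  Matrix.of fun p r => if p.1.1 = r.1.1 then S (p.1.2, p.2) (r.1.2, r.2) else 0

theorem onFst_mul [Fintype m] [Fintype n] [DecidableEq n] (X Y : Matrix m m A) :
    onFst n (X * Y) = onFst n X * onFst n Y := by
  ext ⟨a, b⟩ ⟨c, d⟩
  simp [onFst, Matrix.mul_apply, Fintype.sum_prod_type]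

theorem onFst_one [DecidableEq m] [DecidableEq n] : onFst n (1 : Matrix m m A) = 1 := by
  ext ⟨a, b⟩ ⟨c, d⟩
  by_cases h : a = c <;> simp [onFst, Matrix.one_apply, h]

theorem onLast_mul [Fintype n] [DecidableEq n] (S T : Matrix (n × n) (n × n) A) :
    onLast (S * T) = onLast S * onLast T := by
  ext ⟨⟨a, b⟩, c⟩ ⟨⟨d, e⟩, f⟩
  by_cases h : a = d <;> simp [onLast, Matrix.mul_apply, Fintype.sum_prod_type, h]

theorem onLast_one [DecidableEq n] : onLast (1 : Matrix (n × n) (n × n) A) = 1 := by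
  ext ⟨⟨a, b⟩, c⟩ ⟨⟨d, e⟩, f⟩
  by_cases h : a = d <;> simp [onLast, Matrix.one_apply, h]

theorem onFst_onFst_commute_onLast [Fintype n] [DecidableEq n] (X : Matrix n n A)
    (S : Matrix (n × n) (n × n) A)
    (hS : ∀ p r (a : A), Commute a (S p r)) :
    Commute (onFst n (onFst n X)) (onLast S) := by
  ext ⟨⟨a, b⟩, c⟩ ⟨⟨d, e⟩, f⟩
  simp [onFst, onLast, Matrix.mul_apply, Fintype.sum_prod_type, (hS _ _ _).eq]

theorem partialTr_onFst_mul [Fintype m] [Fintype n] [DecidableEq n]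
    (c : Matrix n n A) (X : Matrix m m A)
    (M : Matrix (m × n) (m × n) A) :
    partialTr c (onFst n X * M) = X * partialTr c M := by
  ext a b
  simp only [partialTr, onFst, Matrix.mul_apply, Fintype.sum_prod_type, Matrix.of_apply,
    mul_ite, mul_one, mul_zero, ite_mul, zero_mul, Finset.sum_ite_eq, Finset.mem_univ, if_true,
    Finset.sum_mul, Finset.mul_sum, mul_assoc]
  rw [Finset.sum_comm_cycle]

theorem partialTr_mul_onFst [Fintype m] [Fintype n] [DecidableEq n]
    (c : Matrix n n A) (hc : ∀ i j (a : A), Commute a (c i j))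
    (M : Matrix (m × n) (m × n) A) (Y : Matrix m m A) :
    partialTr c (M * onFst n Y) = partialTr c M * Y := by
  ext a b
  simp only [partialTr, onFst, Matrix.mul_apply, Fintype.sum_prod_type, Matrix.of_apply,
    mul_ite, mul_one, mul_zero, Finset.sum_ite_eq', Finset.mem_univ, if_true,
    Finset.sum_mul, mul_assoc]
  simp only [(hc _ _ (Y _ _)).eq]
  rw [Finset.sum_comm_cycle]

theorem partialTr_onLast [Fintype n] [DecidableEq n] (c : Matrix n n A)
    (S : Matrix (n × n) (n × n) A)
    (hS : partialTr c S = 1) : partialTr c (onLast S) = 1 := by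
  ext ⟨a, b⟩ ⟨d, e⟩
  have h := congrFun (congrFun hS b) e
  by_cases hd : a = d <;> simp_all [partialTr, onLast, Matrix.one_apply]

theorem sum_partialTr_mul [Fintype m] [Fintype n] (c : Matrix n n A) (w : m → m → A)
    (M : Matrix (m × n) (m × n) A) :
    ∑ a, ∑ b, partialTr c M a b * w b a =
      ∑ p, ∑ r, M p r * (c r.2 p.2 * w r.1 p.1) := by
  simp only [partialTr, Matrix.of_apply, Fintype.sum_prod_type, Finset.sum_mul, mul_assoc]
  exact Finset.sum_congr rfl fun _ _ => Finset.sum_comm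

end RTrace

theorem partialTr_eq_one {N : ℕ} {A : Type*} [Ring A] [Algebra K A]
    (R Ψ : Matrix (Fin N × Fin N) (Fin N × Fin N) K) (C : Matrix (Fin N) (Fin N) K)
    (hΨ : ∀ i p q' k : Fin N,
      (∑ j : Fin N, ∑ l : Fin N, R (i, j) (k, l) * Ψ (l, p) (j, q')) =
        (if i = q' then 1 else 0) * (if p = k then 1 else 0))
    (hC : ∀ i j : Fin N, C i j = ∑ s : Fin N, Ψ (i, s) (j, s)) :
    partialTr (C.map (algebraMap K A)) (R.map (algebraMap K A)) = 1 := by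
  have h (a b : Fin N) :
      ∑ x, ∑ y, R (a, x) (b, y) * C y x = (1 : Matrix (Fin N) (Fin N) K) a b := by
    simp only [hC, Finset.mul_sum]
    rw [Finset.sum_comm_cycle]
    simp [hΨ, Matrix.one_apply]
  ext a b
  simp only [partialTr, Matrix.of_apply, Matrix.map_apply, ← map_mul, ← map_sum, h]
  by_cases hab : a = b <;> simp [Matrix.one_apply, hab]

/-- Triples, as nested pairs or as functions on `Fin 3`. -/
def tripleEquiv (α : Type*) : (α × α) × α ≃ (Fin 3 → α) where
  toFun p := ![p.1.1, p.1.2, p.2]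
  invFun f := ((f 0, f 1), f 2)
  left_inv _ := rfl
  right_inv f := by ext i; fin_cases i <;> rfl

theorem tripleEquiv_apply {α : Type*} (a b c : α) : tripleEquiv α ((a, b), c) = ![a, b, c] := rfl

section Positions

variable {N : ℕ} {A : Type*} [Ring A] [Algebra K A]

theorem liftPos_zero_submatrix (R : Matrix (Fin N × Fin N) (Fin N × Fin N) K) :
    ((liftPos 3 N R 0).map (algebraMap K A)).submatrix (tripleEquiv _) (tripleEquiv _) =
      onFst (Fin N) (R.map (algebraMap K A)) := by
  ext ⟨⟨a, b⟩, c⟩ ⟨⟨d, e⟩, f⟩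
  by_cases h : c = f <;>
  simp [liftPos, onFst, tripleEquiv_apply, Finset.prod_filter, Fin.prod_univ_three, h]

theorem liftPos_one_submatrix (R : Matrix (Fin N × Fin N) (Fin N × Fin N) K) :
    ((liftPos 3 N R 1).map (algebraMap K A)).submatrix (tripleEquiv _) (tripleEquiv _) =
      onLast (R.map (algebraMap K A)) := by
  ext ⟨⟨a, b⟩, c⟩ ⟨⟨d, e⟩, f⟩
  by_cases h : a = d <;>
  simp [liftPos, onLast, tripleEquiv_apply, Finset.prod_filter, Fin.prod_univ_three, h]

theorem embed1_submatrix (hm : 0 < 3) (L : Matrix (Fin N) (Fin N) A) :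
    (embed1 3 N hm L).submatrix (tripleEquiv _) (tripleEquiv _) =
      onFst (Fin N) (onFst (Fin N) L) := by
  ext ⟨⟨a, b⟩, c⟩ ⟨⟨d, e⟩, f⟩
  by_cases h : b = e <;> by_cases h' : c = f <;>
  simp [embed1, onFst, tripleEquiv_apply, Fin.forall_fin_succ, h, h']

theorem sum_sum_eq_sum_partialTr (C : Matrix (Fin N) (Fin N) K)
    (M : Matrix (Fin 3 → Fin N) (Fin 3 → Fin N) A) :
    ∑ I, ∑ J, M I J * algebraMap K A (∏ t, C (J t) (I t)) =
      ∑ i, ∑ j, partialTr (C.map (algebraMap K A)) (partialTr (C.map (algebraMap K A))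
        (M.submatrix (tripleEquiv _) (tripleEquiv _))) i j * algebraMap K A (C j i) := by
  rw [sum_partialTr_mul _ fun j i => algebraMap K A (C j i),
    sum_partialTr_mul _ fun r p : Fin N × Fin N =>
      C.map (algebraMap K A) r.2 p.2 * algebraMap K A (C r.1 p.1),
    ← (tripleEquiv (Fin N)).sum_comp]
  refine Finset.sum_congr rfl fun p _ => ?_
  rw [← (tripleEquiv (Fin N)).sum_comp]
  refine Finset.sum_congr rfl fun r _ => ?_
  obtain ⟨⟨a, b⟩, c⟩ := p
  obtain ⟨⟨d, e⟩, f⟩ := r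
  simp only [Matrix.submatrix_apply, Matrix.map_apply, tripleEquiv_apply,
    Fin.prod_univ_three, Matrix.cons_val, ← map_mul]
  congr 2
  ring

end Positions

/-- Normal form of `r₂r₁ L₁̄L₂̄L₃̄` under the braid and reflection relations. -/
theorem reflection_word {B : Type*} [Ring B] (r₁ r₂ s₁ s₂ l : B)
    (h₁ : r₁ * s₁ = 1) (h₁' : s₁ * r₁ = 1) (h₂ : r₂ * s₂ = 1)
    (hbraid : r₁ * r₂ * r₁ = r₂ * r₁ * r₂) (hr : Commute l r₂) (hs : Commute l s₂)
    (hRE : r₁ * l * r₁ * l = l * r₁ * l * r₁) :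
    r₂ * r₁ * (l * (r₁ * l * s₁) * (r₂ * (r₁ * l * s₁) * s₂)) =
      l * r₁ * l * s₁ * (r₂ * (r₁ * l)) := by
  have hconj : r₂ * r₁ * s₂ = s₁ * r₂ * r₁ := by
    calc r₂ * r₁ * s₂ = s₁ * (r₁ * r₂ * r₁) * s₂ := by simp only [← mul_assoc, h₁', one_mul]
      _ = s₁ * r₂ * r₁ * (r₂ * s₂) := by rw [hbraid]; simp only [mul_assoc]
      _ = s₁ * r₂ * r₁ := by rw [h₂, mul_one]
  calc r₂ * r₁ * (l * (r₁ * l * s₁) * (r₂ * (r₁ * l * s₁) * s₂))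
      = r₂ * (r₁ * l * r₁ * l) * s₁ * r₂ * r₁ * l * s₁ * s₂ := by simp only [mul_assoc]
    _ = r₂ * l * r₁ * l * (r₁ * s₁) * r₂ * r₁ * l * s₁ * s₂ := by
        rw [hRE]; simp only [mul_assoc]
    _ = (r₂ * l) * r₁ * (l * r₂) * r₁ * l * s₁ * s₂ := by
        rw [h₁, mul_one]; simp only [mul_assoc]
    _ = l * (r₂ * r₁ * r₂) * l * r₁ * l * s₁ * s₂ := by
        rw [hr.eq]; simp only [← mul_assoc, hr.eq]
    _ = l * r₁ * r₂ * (r₁ * l * r₁ * l) * s₁ * s₂ := by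
        rw [← hbraid]; simp only [mul_assoc]
    _ = l * r₁ * (r₂ * l) * r₁ * l * (r₁ * s₁) * s₂ := by rw [hRE]; simp only [mul_assoc]
    _ = l * r₁ * l * r₂ * r₁ * (l * s₂) := by
        rw [h₁, mul_one, ← hr.eq]; simp only [mul_assoc]
    _ = l * r₁ * l * (r₂ * r₁ * s₂) * l := by rw [hs.eq]; simp only [mul_assoc]
    _ = l * r₁ * l * s₁ * (r₂ * (r₁ * l)) := by rw [hconj]; simp only [mul_assoc]

/-- in the Reflection Equation algebra, the power sum
p₃(L) = Tr_{R(123)}(R₂R₁ L_{1̄}L_{2̄}L_{3̄}) equals Tr_R(L³). -/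
theorem power_sum_three_eq_trR_cube {N : ℕ}
    {A : Type*} [Ring A] [Algebra K A]
    (R Rinv Ψ : Matrix (Fin N × Fin N) (Fin N × Fin N) K)
    (C : Matrix (Fin N) (Fin N) K) (q : K) (hq0 : q ≠ 0)
    (hbraid : liftPos 3 N R 0 * liftPos 3 N R 1 * liftPos 3 N R 0 =
      liftPos 3 N R 1 * liftPos 3 N R 0 * liftPos 3 N R 1)
    (hHecke : R * R = (q - q⁻¹) • R + 1)
    (hRinv : R * Rinv = 1 ∧ Rinv * R = 1)
    (hΨ : ∀ i p q' k : Fin N,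
      (∑ j : Fin N, ∑ l : Fin N, R (i, j) (k, l) * Ψ (l, p) (j, q')) =
        (if i = q' then 1 else 0) * (if p = k then 1 else 0))
    (hCdef : ∀ i j : Fin N, C i j = ∑ s : Fin N, Ψ (i, s) (j, s))
    (L : Matrix (Fin N) (Fin N) A)
    (hRE : R.map (algebraMap K A) *
          Matrix.of (fun p q' : Fin N × Fin N => L p.1 q'.1 * (if p.2 = q'.2 then 1 else 0)) *
          R.map (algebraMap K A) *
          Matrix.of (fun p q' : Fin N × Fin N => L p.1 q'.1 * (if p.2 = q'.2 then 1 else 0)) =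
        Matrix.of (fun p q' : Fin N × Fin N => L p.1 q'.1 * (if p.2 = q'.2 then 1 else 0)) *
          R.map (algebraMap K A) *
          Matrix.of (fun p q' : Fin N × Fin N => L p.1 q'.1 * (if p.2 = q'.2 then 1 else 0)) *
          R.map (algebraMap K A)) :
    (∑ I : Fin 3 → Fin N, ∑ J : Fin 3 → Fin N,
      ((liftPos 3 N R 1 * liftPos 3 N R 0).map (algebraMap K A) *
        (Lbar 3 N (by norm_num) R Rinv L 0 * Lbar 3 N (by norm_num) R Rinv L 1 *
          Lbar 3 N (by norm_num) R Rinv L 2)) I J *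
        algebraMap K A (∏ t, C (J t) (I t))) =
    ∑ i : Fin N, ∑ j : Fin N, (L * L * L) i j * algebraMap K A (C j i) := by
  have hR : R.map (algebraMap K A) * Rinv.map (algebraMap K A) = 1 := by
    rw [← Matrix.map_mul, hRinv.1]; simp
  have hR' : Rinv.map (algebraMap K A) * R.map (algebraMap K A) = 1 := by
    rw [← Matrix.map_mul, hRinv.2]; simp
  have hcomm (S : Matrix (Fin N × Fin N) (Fin N × Fin N) K) :
      Commute (onFst (Fin N) (onFst (Fin N) L)) (onLast (S.map (algebraMap K A))) :=
    onFst_onFst_commute_onLast _ _ fun p r a => (Algebra.commutes (S p r) a).symm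
  have hc (i j : Fin N) (a : A) : Commute a (C.map (algebraMap K A) i j) :=
    (Algebra.commutes (C i j) a).symm
  have hb : onFst (Fin N) (R.map (algebraMap K A)) * onLast (R.map (algebraMap K A)) *
        onFst (Fin N) (R.map (algebraMap K A)) =
      onLast (R.map (algebraMap K A)) * onFst (Fin N) (R.map (algebraMap K A)) *
        onLast (R.map (algebraMap K A)) := by
    have h := congrArg (fun M => (M.map (algebraMap K A)).submatrix
      (tripleEquiv (Fin N)) (tripleEquiv (Fin N))) hbraid
    simpa only [Matrix.map_mul, ← Matrix.submatrix_mul_equiv _ _ _ (tripleEquiv (Fin N)) _,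
      liftPos_zero_submatrix, liftPos_one_submatrix] using h
  have hRE' := congrArg (onFst (Fin N)) (show R.map (algebraMap K A) * onFst (Fin N) L *
      R.map (algebraMap K A) * onFst (Fin N) L = onFst (Fin N) L * R.map (algebraMap K A) *
      onFst (Fin N) L * R.map (algebraMap K A) from hRE)
  simp only [onFst_mul] at hRE'
  have hone := partialTr_eq_one (A := A) R Ψ C hΨ hCdef
  rw [sum_sum_eq_sum_partialTr]
  simp only [Lbar, Matrix.map_mul, ← Matrix.submatrix_mul_equiv _ _ _ (tripleEquiv (Fin N)) _,
    liftPos_zero_submatrix, liftPos_one_submatrix, embed1_submatrix]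
  have hword := reflection_word _ _ _ _ _
    (by rw [← onFst_mul, hR, onFst_one]) (by rw [← onFst_mul, hR', onFst_one])
    (by rw [← onLast_mul, hR, onLast_one]) hb (hcomm R) (hcomm Rinv) hRE'
  rw [hword]
  simp only [← onFst_mul]
  rw [partialTr_onFst_mul, partialTr_mul_onFst _ hc, partialTr_onLast _ _ hone, one_mul]
  rw [show onFst (Fin N) L * R.map (algebraMap K A) * onFst (Fin N) L *
      Rinv.map (algebraMap K A) * (R.map (algebraMap K A) * onFst (Fin N) L) =
      onFst (Fin N) L * (R.map (algebraMap K A) * onFst (Fin N) (L * L)) by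
    rw [onFst_mul, mul_assoc _ (Rinv.map _), ← mul_assoc (Rinv.map _), hR', one_mul]
    simp only [mul_assoc]]
  rw [partialTr_onFst_mul, partialTr_mul_onFst _ hc, hone, one_mul, mul_assoc]
end
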